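/- arXiv:2512.07046 — 2 statements merged into one kernel-verified Lean document; each statement's English description precedes it below -/
import Mathlib

section
/- Let T>0, B ∈ ℝ^{n×m}, Σ_init ∈ S₊ⁿ, and L ≥ 0. Suppose A : [0,T] → ℝ^{n×n} is locally integrable with ∫₀ᵀ ‖A_t‖_F dt ≤ L, and Σ : [0,T] → Sⁿ is absolutely continuous, satisfies Σ̇_t = A_tΣ_t + Σ_tA_tᵀ + BBᵀ almost everywhere, and Σ_0 = Σ_init. Then for every t ∈ [0,T] the two-sided spectral bounds e^{−2L} λ_min(Σ_init) I ≤ Σ_t ≤ e^{2L} (λ_max(Σ_init) + T λ_max(BBᵀ)) I hold, where λ_min and λ_max denote the smallest and largest eigenvalues. -/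
open MeasureTheory Matrix Set

/-- Frobenius norm of a real matrix. -/
noncomputable def frobNorm {n m : ℕ} (M : Matrix (Fin n) (Fin m) ℝ) : ℝ :=
  Real.sqrt (∑ i, ∑ j, (M i j) ^ 2)

/-- Smallest eigenvalue of a (Hermitian) real matrix. -/
noncomputable def lamMin {n : ℕ} (M : Matrix (Fin n) (Fin n) ℝ) : ℝ :=
  if h : M.IsHermitian then ⨅ i, h.eigenvalues i else 0

/-- Largest eigenvalue of a (Hermitian) real matrix. -/
noncomputable def lamMax {n : ℕ} (M : Matrix (Fin n) (Fin n) ℝ) : ℝ :=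
  if h : M.IsHermitian then ⨆ i, h.eigenvalues i else 0

/-- Loewner order on symmetric matrices: `P ≤ Q` iff `Q − P` is positive semidefinite. -/
def LoewnerLE {n : ℕ} (P Q : Matrix (Fin n) (Fin n) ℝ) : Prop :=
  (Q - P).PosSemidef

lemma sb_quad_diag {n : ℕ} {M : Matrix (Fin n) (Fin n) ℝ} (h : M.IsHermitian) (y : Fin n → ℝ) :
    ∃ z : Fin n → ℝ, y ⬝ᵥ (M *ᵥ y) = ∑ i, h.eigenvalues i * z i ^ 2 ∧
      y ⬝ᵥ y = ∑ i, z i ^ 2 := by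
  set U : Matrix (Fin n) (Fin n) ℝ := (h.eigenvectorUnitary : Matrix (Fin n) (Fin n) ℝ) with hU
  have hUU : U * Uᵀ = 1 := by
    have := Unitary.coe_mul_star_self h.eigenvectorUnitary
    simpa [Matrix.star_eq_conjTranspose, Matrix.conjTranspose_eq_transpose_of_trivial] using this
  have hM : M = U * diagonal h.eigenvalues * Uᵀ := by
    have := h.spectral_theorem
    rw [Unitary.conjStarAlgAut_apply] at this
    simpa [Matrix.star_eq_conjTranspose, Matrix.conjTranspose_eq_transpose_of_trivial,
      Function.comp_def] using this
  refine ⟨Uᵀ *ᵥ y, ?_, ?_⟩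
  · conv_lhs => rw [hM]
    rw [← mulVec_mulVec, ← mulVec_mulVec, dotProduct_mulVec, ← mulVec_transpose]
    simp only [dotProduct, mulVec_diagonal]
    exact Finset.sum_congr rfl fun i _ => by ring
  · have : y ⬝ᵥ y = y ⬝ᵥ ((U * Uᵀ) *ᵥ y) := by rw [hUU, one_mulVec]
    rw [this, ← mulVec_mulVec, dotProduct_mulVec, ← mulVec_transpose]
    simp only [dotProduct]
    exact Finset.sum_congr rfl fun i _ => by ring

lemma sb_eigvec {n : ℕ} {M : Matrix (Fin n) (Fin n) ℝ} (h : M.IsHermitian) (i : Fin n) :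
    ∃ x : Fin n → ℝ, x ⬝ᵥ x = 1 ∧ M *ᵥ x = h.eigenvalues i • x := by
  refine ⟨h.eigenvectorBasis i, ?_, h.mulVec_eigenvectorBasis i⟩
  have := h.eigenvectorBasis.orthonormal.1 i
  rw [EuclideanSpace.norm_eq, Real.sqrt_eq_one] at this
  simpa [dotProduct, pow_two] using this

lemma sb_lamMin {n : ℕ} (hn : 0 < n) {M : Matrix (Fin n) (Fin n) ℝ} (h : M.IsHermitian) :
    (∃ x : Fin n → ℝ, x ⬝ᵥ x = 1 ∧ M *ᵥ x = lamMin M • x) ∧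
    ∀ y : Fin n → ℝ, lamMin M * (y ⬝ᵥ y) ≤ y ⬝ᵥ (M *ᵥ y) := by
  have : Nonempty (Fin n) := ⟨⟨0, hn⟩⟩
  have e : lamMin M = ⨅ i, h.eigenvalues i := by rw [lamMin, dif_pos h]
  constructor
  · obtain ⟨i, hi⟩ := exists_eq_ciInf_of_finite (f := h.eigenvalues)
    rw [e, ← hi]
    exact sb_eigvec h i
  · intro y
    obtain ⟨z, h1, h2⟩ := sb_quad_diag h y
    rw [h1, h2, Finset.mul_sum, e]
    refine Finset.sum_le_sum fun i _ => mul_le_mul_of_nonneg_right ?_ (sq_nonneg _)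
    exact ciInf_le (Set.finite_range _).bddBelow i

lemma sb_lamMax {n : ℕ} (hn : 0 < n) {M : Matrix (Fin n) (Fin n) ℝ} (h : M.IsHermitian) :
    (∃ x : Fin n → ℝ, x ⬝ᵥ x = 1 ∧ M *ᵥ x = lamMax M • x) ∧
    ∀ y : Fin n → ℝ, y ⬝ᵥ (M *ᵥ y) ≤ lamMax M * (y ⬝ᵥ y) := by
  have : Nonempty (Fin n) := ⟨⟨0, hn⟩⟩
  have e : lamMax M = ⨆ i, h.eigenvalues i := by rw [lamMax, dif_pos h]
  constructor
  · obtain ⟨i, hi⟩ := exists_eq_ciSup_of_finite (f := h.eigenvalues)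
    rw [e, ← hi]
    exact sb_eigvec h i
  · intro y
    obtain ⟨z, h1, h2⟩ := sb_quad_diag h y
    rw [h1, h2, Finset.mul_sum, e]
    refine Finset.sum_le_sum fun i _ => mul_le_mul_of_nonneg_right ?_ (sq_nonneg _)
    exact le_ciSup (Set.finite_range _).bddAbove i

lemma sb_quad_expand {n : ℕ} (M : Matrix (Fin n) (Fin n) ℝ) (x : Fin n → ℝ) :
    x ⬝ᵥ (M *ᵥ x) = ∑ i, ∑ j, x i * x j * M i j := by
  simp only [dotProduct, mulVec, Finset.mul_sum]
  exact Finset.sum_congr rfl fun i _ => Finset.sum_congr rfl fun j _ => by ring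

lemma sb_frob {n : ℕ} (M : Matrix (Fin n) (Fin n) ℝ) (x : Fin n → ℝ) (hx : x ⬝ᵥ x = 1) :
    |x ⬝ᵥ (M *ᵥ x)| ≤ frobNorm M := by
  rw [frobNorm]
  apply Real.abs_le_sqrt
  rw [sb_quad_expand, ← Finset.sum_product', ← Finset.sum_product']
  refine (Finset.sum_mul_sq_le_sq_mul_sq _ _ _).trans ?_
  have : ∑ p ∈ (Finset.univ : Finset (Fin n)) ×ˢ (Finset.univ : Finset (Fin n)),
      (x p.1 * x p.2) ^ 2 = 1 := by
    rw [Finset.sum_product]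
    have h2 : ∑ i, x i ^ 2 = 1 := by simpa [dotProduct, pow_two] using hx
    simp only [mul_pow, ← Finset.mul_sum, h2, mul_one]
  rw [this, one_mul]

lemma sb_ac_of_dist_le {ι : Type*} [Fintype ι] {f : ℝ → ℝ} {g : ι → ℝ → ℝ} {a b K : ℝ}
    (hg : ∀ i, AbsolutelyContinuousOnInterval (g i) a b)
    (h : ∀ s ∈ uIcc a b, ∀ t ∈ uIcc a b, dist (f s) (f t) ≤ K * ∑ i, dist (g i s) (g i t)) :
    AbsolutelyContinuousOnInterval f a b := by
  unfold AbsolutelyContinuousOnInterval at hg ⊢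
  have h1 := (tendsto_finsetSum Finset.univ fun i _ => hg i).const_mul K
  simp only [Finset.sum_const_zero, mul_zero] at h1
  refine squeeze_zero' (Filter.Eventually.of_forall fun E =>
    Finset.sum_nonneg fun i _ => dist_nonneg) ?_ h1
  filter_upwards [Filter.mem_inf_of_right (Filter.mem_principal_self _)] with E hE
  rw [Finset.sum_comm, Finset.mul_sum]
  refine Finset.sum_le_sum fun k hk => ?_
  have := hE.1 k hk
  exact h _ this.1 _ this.2

lemma sb_mono {g : ℝ → ℝ} {a b : ℝ} (hab : a ≤ b) (hg : AbsolutelyContinuousOnInterval g a b)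
    (h : ∀ᵐ t, t ∈ Ioo a b → ∃ d, 0 ≤ d ∧ HasDerivAt g d t) : g a ≤ g b := by
  have h1 := hg.integral_deriv_eq_sub
  have h2 : 0 ≤ ∫ x in a..b, deriv g x := by
    apply intervalIntegral.integral_nonneg_of_ae_restrict hab
    rw [← restrict_Ioo_eq_restrict_Icc]
    rw [Filter.EventuallyLE, ae_restrict_iff' measurableSet_Ioo]
    filter_upwards [h] with t ht hm
    obtain ⟨d, hd, hd'⟩ := ht hm
    simpa [hd'.deriv] using hd
  linarith

lemma sb_env {n : ℕ} {T : ℝ} (hT : 0 < T) (f : ℝ → ℝ) (S D : ℝ → Matrix (Fin n) (Fin n) ℝ)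
    (hDint : ∀ i j, IntegrableOn (fun t => D t i j) (Icc (0:ℝ) T))
    (hSac : ∀ t ∈ Icc (0:ℝ) T, ∀ i j,
      S t i j = S 0 i j + ∫ s in (0:ℝ)..t, D s i j)
    (hle : ∀ t ∈ Icc (0:ℝ) T, ∀ y : Fin n → ℝ, f t * (y ⬝ᵥ y) ≤ y ⬝ᵥ (S t *ᵥ y))
    (hex : ∀ t ∈ Icc (0:ℝ) T, ∃ x : Fin n → ℝ, x ⬝ᵥ x = 1 ∧ S t *ᵥ x = f t • x) :
    AbsolutelyContinuousOnInterval f 0 T ∧ ∀ᵐ t, t ∈ Ioo (0:ℝ) T →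
      ∃ x : Fin n → ℝ, x ⬝ᵥ x = 1 ∧ S t *ᵥ x = f t • x ∧
        HasDerivAt f (x ⬝ᵥ (D t *ᵥ x)) t := by
  have hu : uIcc (0:ℝ) T = Icc 0 T := uIcc_of_le hT.le
  have hDi : ∀ i j, IntervalIntegrable (fun t => D t i j) volume 0 T := fun i j =>
    (intervalIntegrable_iff_integrableOn_Icc_of_le hT.le).2 (hDint i j)
  have hI : ∀ p : Fin n × Fin n,
      AbsolutelyContinuousOnInterval (fun t => ∫ s in (0:ℝ)..t, D s p.1 p.2) 0 T := fun p =>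
    (hDi p.1 p.2).absolutelyContinuousOnInterval_intervalIntegral (by simp)
  have hxle : ∀ x : Fin n → ℝ, x ⬝ᵥ x = 1 → ∀ i, |x i| ≤ 1 := by
    intro x hx i
    rw [← sq_le_one_iff_abs_le_one, ← hx, pow_two]
    exact Finset.single_le_sum (f := fun i => x i * x i) (fun j _ => mul_self_nonneg _)
      (Finset.mem_univ i)
  have key : ∀ s ∈ Icc (0:ℝ) T, ∀ t ∈ Icc (0:ℝ) T, f s - f t ≤
      ∑ p : Fin n × Fin n, dist (∫ r in (0:ℝ)..s, D r p.1 p.2) (∫ r in (0:ℝ)..t, D r p.1 p.2) := by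
    intro s hs t ht
    obtain ⟨x, hx, hxe⟩ := hex t ht
    have h1 := hle s hs x
    have h2 : x ⬝ᵥ (S t *ᵥ x) = f t := by rw [hxe, dotProduct_smul, hx]; simp
    rw [hx, mul_one] at h1
    rw [← h2]
    refine (sub_le_sub_right h1 _).trans ?_
    rw [sb_quad_expand, sb_quad_expand, ← Finset.sum_product', ← Finset.sum_product',
      ← Finset.sum_sub_distrib, Finset.univ_product_univ]
    refine Finset.sum_le_sum fun p _ => ?_
    rw [← mul_sub, hSac s hs, hSac t ht, add_sub_add_left_eq_sub, Real.dist_eq]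
    refine (le_abs_self _).trans ?_
    rw [abs_mul, abs_mul]
    have := mul_le_one₀ (hxle x hx p.1) (abs_nonneg _) (hxle x hx p.2)
    exact mul_le_of_le_one_left (abs_nonneg _) this
  have hac : AbsolutelyContinuousOnInterval f 0 T := by
    refine sb_ac_of_dist_le (K := 1) hI ?_
    rw [hu]
    intro s hs t ht
    rw [one_mul, Real.dist_eq, abs_le]
    refine ⟨?_, key s hs t ht⟩
    have := key t ht s hs
    rw [Finset.sum_congr rfl fun p _ => dist_comm _ _] at this
    linarith
  refine ⟨hac, ?_⟩
  have hd : ∀ᵐ t, ∀ i j, t ∈ uIcc 0 T → ∀ c ∈ uIcc 0 T,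
      HasDerivAt (fun x => ∫ r in c..x, D r i j) (D t i j) t := by
    rw [ae_all_iff]; intro i; rw [ae_all_iff]; intro j
    exact (hDi i j).ae_hasDerivAt_integral
  filter_upwards [hd, hac.ae_differentiableAt] with t h1 h2 ht
  have htI := Ioo_subset_Icc_self ht
  have htu : t ∈ uIcc 0 T := hu ▸ htI
  have hnb : Icc 0 T ∈ nhds t := Icc_mem_nhds ht.1 ht.2
  have hS : ∀ i j, HasDerivAt (fun s => S s i j) (D t i j) t := by
    intro i j
    have := (h1 i j htu 0 (by simp)).const_add (S 0 i j)
    refine this.congr_of_eventuallyEq ?_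
    filter_upwards [hnb] with s hs using hSac s hs i j
  obtain ⟨x, hx, hxe⟩ := hex t htI
  refine ⟨x, hx, hxe, ?_⟩
  have hq : HasDerivAt (fun s => x ⬝ᵥ (S s *ᵥ x)) (x ⬝ᵥ (D t *ᵥ x)) t := by
    simp only [sb_quad_expand]
    exact HasDerivAt.fun_sum fun i _ => HasDerivAt.fun_sum fun j _ => (hS i j).const_mul _
  have hf := (h2 htu).hasDerivAt
  have hm : IsLocalMin (fun s => x ⬝ᵥ (S s *ᵥ x) - f s) t := by
    filter_upwards [hnb] with s hs
    have h3 := hle s hs x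
    have h4 : x ⬝ᵥ (S t *ᵥ x) = f t := by rw [hxe, dotProduct_smul, hx]; simp
    rw [hx] at h3
    linarith
  have h0 := hm.hasDerivAt_eq_zero (hq.fun_sub hf)
  rw [sub_eq_zero.1 h0]
  exact hf

/-- two-sided spectral bounds for trajectories of the controlled
Lyapunov equation, in terms of the `L¹` size of the control. -/
theorem spectral_bounds_of_lyapunov
    {n m : ℕ} (T L : ℝ) (hT : 0 < T) (hL : 0 ≤ L)
    (B : Matrix (Fin n) (Fin m) ℝ)
    (Si : Matrix (Fin n) (Fin n) ℝ) (hSi : Si.PosDef)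
    (A S D : ℝ → Matrix (Fin n) (Fin n) ℝ)
    -- `A` is locally integrable on `[0,T]` with `∫₀ᵀ ‖A_t‖_F dt ≤ L`
    (hAint : ∀ i j, IntegrableOn (fun t => A t i j) (Icc (0:ℝ) T))
    (hAnorm : IntegrableOn (fun t => frobNorm (A t)) (Icc (0:ℝ) T))
    (hAL : ∫ t in Icc (0:ℝ) T, frobNorm (A t) ≤ L)
    -- `Σ` is symmetric-valued and absolutely continuous with derivative `D`
    (hSsymm : ∀ t ∈ Icc (0:ℝ) T, (S t).IsSymm)
    (hDint : ∀ i j, IntegrableOn (fun t => D t i j) (Icc (0:ℝ) T))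
    (hSac : ∀ t ∈ Icc (0:ℝ) T, ∀ i j,
      S t i j = S 0 i j + ∫ s in (0:ℝ)..t, D s i j)
    -- the Lyapunov dynamics hold almost everywhere on `[0,T]`
    (hdyn : ∀ᵐ t ∂(volume.restrict (Icc (0:ℝ) T)),
      D t = A t * S t + S t * (A t)ᵀ + B * Bᵀ)
    -- the initial condition
    (hS0 : S 0 = Si) :
    ∀ t ∈ Icc (0:ℝ) T,
      LoewnerLE ((Real.exp (-(2*L)) * lamMin Si) • (1 : Matrix (Fin n) (Fin n) ℝ)) (S t) ∧
      LoewnerLE (S t)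
        ((Real.exp (2*L) * (lamMax Si + T * lamMax (B * Bᵀ))) •
          (1 : Matrix (Fin n) (Fin n) ℝ)) := by
  rcases Nat.eq_zero_or_pos n with hn | hn
  · subst hn
    intro t _
    have h0 : ∀ P Q : Matrix (Fin 0) (Fin 0) ℝ, LoewnerLE P Q := by
      intro P Q
      rw [LoewnerLE, Subsingleton.elim (Q - P) 0]
      exact PosSemidef.zero
    exact ⟨h0 _ _, h0 _ _⟩
  have hu : uIcc (0:ℝ) T = Icc 0 T := uIcc_of_le hT.le
  have hH : ∀ t ∈ Icc (0:ℝ) T, (S t).IsHermitian := by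
    intro t ht
    rw [IsHermitian, conjTranspose_eq_transpose_of_trivial]
    exact hSsymm t ht
  have hBH : (B * Bᵀ).IsHermitian := by
    rw [IsHermitian, conjTranspose_eq_transpose_of_trivial]
    simp
  have hBq : ∀ x : Fin n → ℝ, 0 ≤ x ⬝ᵥ ((B * Bᵀ) *ᵥ x) := by
    intro x
    rw [← mulVec_mulVec, dotProduct_mulVec, ← mulVec_transpose]
    exact Finset.sum_nonneg fun i _ => mul_self_nonneg _
  obtain ⟨⟨xb, hxb, hxbe⟩, hBle⟩ := sb_lamMax hn hBH
  set β := lamMax (B * Bᵀ) with hβ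
  have hβ0 : 0 ≤ β := by
    have := hBq xb
    rwa [hxbe, dotProduct_smul, hxb, smul_eq_mul, mul_one] at this
  have hfn : ∀ t, 0 ≤ frobNorm (A t) := fun t => Real.sqrt_nonneg _
  have hAi : IntervalIntegrable (fun t => frobNorm (A t)) volume 0 T :=
    (intervalIntegrable_iff_integrableOn_Icc_of_le hT.le).2 hAnorm
  set α : ℝ → ℝ := fun t => ∫ s in (0:ℝ)..t, frobNorm (A s) with hα
  have hα0 : α 0 = 0 := by simp [hα]
  have hαac : AbsolutelyContinuousOnInterval α 0 T :=
    hAi.absolutelyContinuousOnInterval_intervalIntegral (by simp)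
  have hαnn : ∀ t ∈ Icc (0:ℝ) T, 0 ≤ α t := fun t ht =>
    intervalIntegral.integral_nonneg ht.1 fun s _ => hfn s
  have hαL : ∀ t ∈ Icc (0:ℝ) T, α t ≤ L := by
    intro t ht
    refine le_trans ?_ hAL
    simp only [hα]
    rw [intervalIntegral.integral_of_le ht.1]
    exact setIntegral_mono_set hAnorm (Filter.Eventually.of_forall fun s => hfn s)
      (Filter.Eventually.of_forall fun s hs => ⟨hs.1.le, hs.2.trans ht.2⟩)
  have hαd : ∀ᵐ t, t ∈ uIcc 0 T → ∀ c ∈ uIcc 0 T,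
      HasDerivAt (fun x => ∫ r in c..x, frobNorm (A r)) (frobNorm (A t)) t :=
    hAi.ae_hasDerivAt_integral
  have hexp : ∀ c : ℝ, AbsolutelyContinuousOnInterval (fun t => Real.exp (c * α t)) 0 T := by
    intro c
    have hK : ∃ K : NNReal, LipschitzOnWith K (fun u : ℝ => Real.exp (c * u)) (Icc 0 L) :=
      ContDiffOn.exists_lipschitzOnWith (n := 1) (by fun_prop) (by decide) (convex_Icc _ _)
        isCompact_Icc
    obtain ⟨K, hK⟩ := hK
    refine sb_ac_of_dist_le (ι := Unit) (g := fun _ => α) (K := K) (fun _ => hαac) ?_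
    rw [hu]
    intro s hs t ht
    simpa using hK.dist_le_mul _ ⟨hαnn s hs, hαL s hs⟩ _ ⟨hαnn t ht, hαL t ht⟩
  have hexpd : ∀ (c t a : ℝ), HasDerivAt α a t →
      HasDerivAt (fun t => Real.exp (c * α t)) (Real.exp (c * α t) * (c * a)) t :=
    fun c t a h => (h.const_mul c).exp
  rw [ae_restrict_iff' measurableSet_Icc] at hdyn
  -- quadratic form of the dynamics along an eigenvector
  have hquad : ∀ t ∈ Icc (0:ℝ) T, D t = A t * S t + S t * (A t)ᵀ + B * Bᵀ →
      ∀ (l : ℝ) (x : Fin n → ℝ), S t *ᵥ x = l • x →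
      x ⬝ᵥ (D t *ᵥ x) = 2 * l * (x ⬝ᵥ (A t *ᵥ x)) + x ⬝ᵥ ((B * Bᵀ) *ᵥ x) := by
    intro t ht hD l x hx
    have e1 : x ⬝ᵥ ((A t * S t) *ᵥ x) = l * (x ⬝ᵥ (A t *ᵥ x)) := by
      rw [← mulVec_mulVec, hx, mulVec_smul, dotProduct_smul, smul_eq_mul]
    have e2 : x ⬝ᵥ ((S t * (A t)ᵀ) *ᵥ x) = l * (x ⬝ᵥ (A t *ᵥ x)) := by
      rw [← mulVec_mulVec, dotProduct_mulVec, ← mulVec_transpose, (hSsymm t ht).eq, hx,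
        smul_dotProduct, smul_eq_mul, dotProduct_mulVec, vecMul_transpose, dotProduct_comm]
    rw [hD, add_mulVec, add_mulVec, dotProduct_add, dotProduct_add, e1, e2]
    ring
  -- lower bound
  set μ : ℝ → ℝ := fun t => lamMin (S t) with hμ
  obtain ⟨hμac, hμd⟩ := sb_env hT μ S D hDint hSac
    (fun t ht => (sb_lamMin hn (hH t ht)).2) (fun t ht => (sb_lamMin hn (hH t ht)).1)
  have h0mem : (0:ℝ) ∈ Icc (0:ℝ) T := ⟨le_rfl, hT.le⟩
  have hμ0 : 0 < μ 0 := by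
    obtain ⟨x, hx, hxe⟩ := (sb_lamMin hn (hH 0 h0mem)).1
    have hx0 : x ≠ 0 := by
      rintro rfl
      simp at hx
    have := hSi.dotProduct_mulVec_pos hx0
    rw [← hS0, hxe, star_trivial, dotProduct_smul, hx, smul_eq_mul, mul_one] at this
    exact this
  set h : ℝ → ℝ := fun t => Real.exp (2 * α t) * μ t with hh
  have hhac : AbsolutelyContinuousOnInterval h 0 T := (hexp 2).mul hμac
  have hh0 : h 0 = μ 0 := by simp [hh, hα0]
  have hhd : ∀ᵐ t, t ∈ Ioo (0:ℝ) T → 0 ≤ h t → ∃ d, 0 ≤ d ∧ HasDerivAt h d t := by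
    filter_upwards [hμd, hαd, hdyn] with t h1 h2 h3 ht hpos
    have htI := Ioo_subset_Icc_self ht
    obtain ⟨x, hx, hxe, hder⟩ := h1 ht
    have hμt : 0 ≤ μ t := nonneg_of_mul_nonneg_right hpos (Real.exp_pos _)
    refine ⟨_, ?_, (hexpd 2 t _ (h2 (hu ▸ htI) 0 (by simp))).mul hder⟩
    rw [hquad t htI (h3 htI) _ x hxe]
    have hf := (abs_le.1 (sb_frob (A t) x hx)).1
    have hb := hBq x
    have : 0 ≤ Real.exp (2 * α t) * (2 * (μ t * (frobNorm (A t) + x ⬝ᵥ (A t *ᵥ x)))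
        + x ⬝ᵥ ((B * Bᵀ) *ᵥ x)) := by
      have : 0 ≤ frobNorm (A t) + x ⬝ᵥ (A t *ᵥ x) := by linarith
      positivity
    calc 0 ≤ _ := this
      _ = _ := by ring
  have hcont : ContinuousOn h (Icc 0 T) := hu ▸ hhac.continuousOn
  have hlow : Icc (0:ℝ) T ⊆ {t | h 0 ≤ h t} := by
    apply IsClosed.Icc_subset_of_forall_exists_gt
    · have := hcont.preimage_isClosed_of_isClosed isClosed_Icc (isClosed_Ici (a := h 0))
      rwa [inter_comm] at this
    · exact le_refl (h 0)
    · rintro t ⟨ht1, ht⟩ y hy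
      have ht1 : h 0 ≤ h t := ht1
      have hy : t < y := hy
      have htI := Ico_subset_Icc_self ht
      have hev : ∀ᶠ s in nhdsWithin t (Icc 0 T), 0 < h s :=
        (hcont t htI).eventually (lt_mem_nhds (by linarith))
      rw [eventually_nhdsWithin_iff, Metric.eventually_nhds_iff] at hev
      obtain ⟨ε, hε, hev⟩ := hev
      set z := min (min y T) (t + ε / 2) with hz
      have hzt : t < z := lt_min (lt_min hy ht.2) (by linarith)
      have hzy : z ≤ y := (min_le_left _ _).trans (min_le_left _ _)
      have hzT : z ≤ T := (min_le_left _ _).trans (min_le_right _ _)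
      have hze : z ≤ t + ε / 2 := min_le_right _ _
      refine ⟨z, ht1.trans ?_, hzt, hzy⟩
      apply sb_mono hzt.le
      · apply hhac.mono
        rw [hu, uIcc_of_le hzt.le]
        exact Icc_subset_Icc ht.1 hzT
      · filter_upwards [hhd] with s hs hsm
        have hs1 : s ∈ Ioo (0:ℝ) T := ⟨ht.1.trans_lt hsm.1, hsm.2.trans_le hzT⟩
        refine hs hs1 (hev ?_ (Ioo_subset_Icc_self hs1)).le
        rw [Real.dist_eq, abs_lt]
        constructor <;> linarith [hsm.1, hsm.2]
  have hexpinv : ∀ t, Real.exp (2 * α t) * Real.exp (-(2 * α t)) = 1 := by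
    intro t
    rw [← Real.exp_add]; simp
  have hlow2 : ∀ t ∈ Icc (0:ℝ) T, Real.exp (-(2*L)) * μ 0 ≤ μ t := by
    intro t ht
    have h1 : μ 0 ≤ Real.exp (2 * α t) * μ t := hh0 ▸ hlow ht
    have h2 : Real.exp (-(2*L)) ≤ Real.exp (-(2 * α t)) :=
      Real.exp_le_exp.2 (by linarith [hαL t ht])
    calc Real.exp (-(2*L)) * μ 0 ≤ Real.exp (-(2 * α t)) * (Real.exp (2 * α t) * μ t) := by
          gcongr
      _ = (Real.exp (2 * α t) * Real.exp (-(2 * α t))) * μ t := by ring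
      _ = μ t := by rw [hexpinv, one_mul]
  have hμpos : ∀ t ∈ Icc (0:ℝ) T, 0 < μ t := fun t ht =>
    lt_of_lt_of_le (by positivity) (hlow2 t ht)
  -- upper bound
  set ν : ℝ → ℝ := fun t => lamMax (S t) with hν
  have hνpos : ∀ t ∈ Icc (0:ℝ) T, 0 ≤ ν t := by
    intro t ht
    obtain ⟨x, hx, hxe⟩ := (sb_lamMin hn (hH t ht)).1
    have h1 := (sb_lamMax hn (hH t ht)).2 x
    rw [hxe, dotProduct_smul, hx, smul_eq_mul, mul_one, mul_one] at h1
    exact (hμpos t ht).le.trans h1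
  obtain ⟨hνac, hνd⟩ := sb_env hT (fun t => - ν t) (fun t => - S t) (fun t => - D t)
    (fun i j => (hDint i j).neg)
    (fun t ht i j => by
      change -(S t i j) = -(S 0 i j) + ∫ s in (0:ℝ)..t, -(D s i j)
      rw [intervalIntegral.integral_neg, hSac t ht i j]; ring)
    (fun t ht y => by
      have := (sb_lamMax hn (hH t ht)).2 y
      rw [neg_mulVec, dotProduct_neg]
      linarith)
    (fun t ht => by
      obtain ⟨x, hx, hxe⟩ := (sb_lamMax hn (hH t ht)).1
      exact ⟨x, hx, by rw [neg_mulVec, hxe, neg_smul]⟩)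
  have hupp : ∀ t ∈ Icc (0:ℝ) T, ν t ≤ Real.exp (2*L) * (ν 0 + T * β) := by
    intro t ht
    have hidac : AbsolutelyContinuousOnInterval (fun s : ℝ => β * s) 0 T :=
      ContDiffOn.absolutelyContinuousOnInterval (by fun_prop)
    have hkac := hidac.fun_add ((hexp (-2)).fun_mul hνac)
    have hm := sb_mono ht.1 (hkac.mono (by
      rw [hu, uIcc_of_le ht.1]; exact Icc_subset_Icc le_rfl ht.2)) (by
      filter_upwards [hνd, hαd, hdyn] with s h1 h2 h3 hs
      have hs' : s ∈ Ioo (0:ℝ) T := ⟨hs.1, hs.2.trans_le ht.2⟩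
      have hsI := Ioo_subset_Icc_self hs'
      obtain ⟨x, hx, hxe, hder⟩ := h1 hs'
      have hxe' : S s *ᵥ x = ν s • x := by
        rw [neg_mulVec, neg_smul] at hxe
        exact neg_injective hxe
      refine ⟨_, ?_, ((hasDerivAt_id s).const_mul β).fun_add
        ((hexpd (-2) s _ (h2 (hu ▸ hsI) 0 (by simp))).fun_mul hder)⟩
      rw [neg_mulVec, dotProduct_neg, hquad s hsI (h3 hsI) _ x hxe']
      have hf := (abs_le.1 (sb_frob (A s) x hx)).2
      have hb := hBle x
      rw [hx, mul_one] at hb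
      have hν0 := hνpos s hsI
      have he : Real.exp (-2 * α s) ≤ 1 := Real.exp_le_one_iff.2 (by linarith [hαnn s hsI])
      have h5 : Real.exp (-2 * α s) * (x ⬝ᵥ ((B * Bᵀ) *ᵥ x)) ≤ β :=
        (mul_le_mul he hb (hBq x) zero_le_one).trans (one_mul β).le
      have h6 : 0 ≤ Real.exp (-2 * α s) * (2 * (ν s * (frobNorm (A s) - x ⬝ᵥ (A s *ᵥ x)))) := by
        have : 0 ≤ frobNorm (A s) - x ⬝ᵥ (A s *ᵥ x) := by linarith
        positivity
      calc 0 ≤ (β - Real.exp (-2 * α s) * (x ⬝ᵥ ((B * Bᵀ) *ᵥ x))) +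
            Real.exp (-2 * α s) * (2 * (ν s * (frobNorm (A s) - x ⬝ᵥ (A s *ᵥ x)))) := by linarith
        _ = _ := by ring)
    simp only [hα0, mul_zero, Real.exp_zero, one_mul, zero_add] at hm
    have hm2 : Real.exp (-(2 * α t)) * ν t ≤ ν 0 + T * β := by
      have : β * t ≤ T * β := by nlinarith [ht.2]
      rw [neg_mul] at hm
      linarith
    have hν00 := hνpos 0 h0mem
    calc ν t = Real.exp (2 * α t) * (Real.exp (-(2 * α t)) * ν t) := by
          rw [← mul_assoc, hexpinv, one_mul]
      _ ≤ Real.exp (2 * α t) * (ν 0 + T * β) := by gcongr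
      _ ≤ Real.exp (2 * L) * (ν 0 + T * β) := by
          have := hαL t ht
          gcongr
  -- conclusion
  intro t ht
  have hc : ∀ c : ℝ, (c • (1 : Matrix (Fin n) (Fin n) ℝ)).IsHermitian := by
    intro c
    rw [IsHermitian, conjTranspose_eq_transpose_of_trivial]
    simp
  rw [← hS0]
  constructor
  · refine PosSemidef.of_dotProduct_mulVec_nonneg ((hH t ht).sub (hc _)) fun y => ?_
    have h1 := (sb_lamMin hn (hH t ht)).2 y
    have h2 := hlow2 t ht
    have h3 : 0 ≤ y ⬝ᵥ y := Finset.sum_nonneg fun i _ => mul_self_nonneg _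
    rw [star_trivial, sub_mulVec, dotProduct_sub, smul_mulVec, one_mulVec, dotProduct_smul,
      smul_eq_mul, sub_nonneg]
    exact (mul_le_mul_of_nonneg_right h2 h3).trans h1
  · refine PosSemidef.of_dotProduct_mulVec_nonneg ((hc _).sub (hH t ht)) fun y => ?_
    have h1 := (sb_lamMax hn (hH t ht)).2 y
    have h2 := hupp t ht
    have h3 : 0 ≤ y ⬝ᵥ y := Finset.sum_nonneg fun i _ => mul_self_nonneg _
    rw [star_trivial, sub_mulVec, dotProduct_sub, smul_mulVec, one_mulVec, dotProduct_smul,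
      smul_eq_mul, sub_nonneg]
    exact h1.trans (mul_le_mul_of_nonneg_right h2 h3)
end

section
/- Fix T>0, B ∈ ℝ^{n×m}, and α ∈ (0,1). Suppose A : [0,T] → ℝ^{n×n} is continuously differentiable, Σ : [0,T] → Sⁿ is twice continuously differentiable with Σ_t positive definite for every t, and Λ : [0,T] → Sⁿ is continuously differentiable, and the following hold for all t ∈ [0,T]: Σ̇ = AΣ + ΣAᵀ + BBᵀ; −Λ̇ = ΛA + AᵀΛ − (1−α)ȦᵀȦ; and the map t ↦ Ȧ_tΣ_t is continuously differentiable with ΛΣ = αA − (1−α) d/dt(ȦΣ). Then A, Σ, and Λ are infinitely differentiable (C^∞) on [0,T]. -/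
open MeasureTheory Matrix Set

/-- Entrywise `C^k` regularity of a matrix-valued function on a set. -/
def EntryC (k : ℕ) (s : Set ℝ) {n : ℕ} (M : ℝ → Matrix (Fin n) (Fin n) ℝ) : Prop :=
  ∀ i j, ContDiffOn ℝ k (fun t => M t i j) s

lemma EntryC.congr {k : ℕ} {s : Set ℝ} {n : ℕ} {M N : ℝ → Matrix (Fin n) (Fin n) ℝ}
    (hM : EntryC k s M) (h : ∀ t ∈ s, N t = M t) : EntryC k s N := fun i j =>
  (hM i j).congr (fun t ht => by simp only [h t ht])

lemma EntryC.mul {k : ℕ} {s : Set ℝ} {n : ℕ} {M N : ℝ → Matrix (Fin n) (Fin n) ℝ}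
    (hM : EntryC k s M) (hN : EntryC k s N) : EntryC k s (fun t => M t * N t) := by
  intro i j
  simp only [Matrix.mul_apply]
  exact ContDiffOn.sum (fun l _ => (hM i l).mul (hN l j))

lemma EntryC.add {k : ℕ} {s : Set ℝ} {n : ℕ} {M N : ℝ → Matrix (Fin n) (Fin n) ℝ}
    (hM : EntryC k s M) (hN : EntryC k s N) : EntryC k s (fun t => M t + N t) :=
  fun i j => (hM i j).add (hN i j)

lemma EntryC.sub {k : ℕ} {s : Set ℝ} {n : ℕ} {M N : ℝ → Matrix (Fin n) (Fin n) ℝ}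
    (hM : EntryC k s M) (hN : EntryC k s N) : EntryC k s (fun t => M t - N t) :=
  fun i j => (hM i j).sub (hN i j)

lemma EntryC.smul {k : ℕ} {s : Set ℝ} {n : ℕ} {M : ℝ → Matrix (Fin n) (Fin n) ℝ}
    (c : ℝ) (hM : EntryC k s M) : EntryC k s (fun t => c • M t) :=
  fun i j => contDiffOn_const.mul (hM i j)

lemma EntryC.transpose {k : ℕ} {s : Set ℝ} {n : ℕ} {M : ℝ → Matrix (Fin n) (Fin n) ℝ}
    (hM : EntryC k s M) : EntryC k s (fun t => (M t)ᵀ) :=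
  fun i j => hM j i

lemma EntryC.const {k : ℕ} {s : Set ℝ} {n : ℕ} (M : Matrix (Fin n) (Fin n) ℝ) :
    EntryC k s (fun _ => M) :=
  fun _ _ => contDiffOn_const

lemma EntryC.det {k : ℕ} {s : Set ℝ} {n : ℕ} {M : ℝ → Matrix (Fin n) (Fin n) ℝ}
    (hM : EntryC k s M) : ContDiffOn ℝ k (fun t => (M t).det) s := by
  simp only [Matrix.det_apply']
  exact ContDiffOn.sum (fun σ _ => contDiffOn_const.mul (contDiffOn_prod (fun l _ => hM _ _)))

lemma EntryC.inv {k : ℕ} {s : Set ℝ} {n : ℕ} {M : ℝ → Matrix (Fin n) (Fin n) ℝ}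
    (hM : EntryC k s M) (h : ∀ t ∈ s, (M t).det ≠ 0) : EntryC k s (fun t => (M t)⁻¹) := by
  intro i j
  simp only [Matrix.inv_def, Matrix.smul_apply, Ring.inverse_eq_inv', smul_eq_mul,
    Matrix.adjugate_apply]
  refine (hM.det.inv h).mul (EntryC.det (fun a b => ?_))
  simp only [Matrix.updateRow_apply]
  split_ifs
  · exact contDiffOn_const
  · exact hM a b

lemma EntryC.succ {k : ℕ} {T : ℝ} (hT : 0 < T) {n : ℕ} {M M' : ℝ → Matrix (Fin n) (Fin n) ℝ}
    (hd : ∀ t ∈ Icc (0:ℝ) T, ∀ i j,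
      HasDerivWithinAt (fun s => M s i j) (M' t i j) (Icc (0:ℝ) T) t)
    (hM : EntryC k (Icc (0:ℝ) T) M') : EntryC (k + 1) (Icc (0:ℝ) T) M := by
  intro i j
  have hu := uniqueDiffOn_Icc hT
  push_cast
  rw [contDiffOn_succ_iff_derivWithin hu]
  refine ⟨fun t ht => (hd t ht i j).differentiableWithinAt, by simp, ?_⟩
  exact (hM i j).congr (fun t ht => (hd t ht i j).derivWithin (hu t ht))

/-- smoothness of solutions of the first-order optimality system.
If `A` is `C¹`, `Σ` is `C²` and pointwise positive definite, `Λ` is `C¹`, these are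
symmetric where required, and the primal, adjoint, and stationarity equations hold on
`[0,T]` (with `t ↦ ȦΣ` being `C¹`), then `A`, `Σ`, `Λ` are `C^∞` on `[0,T]`. -/
theorem smoothness_of_fonc_solutions
    {n m : ℕ} (T α : ℝ) (hT : 0 < T) (hα : α ∈ Set.Ioo (0:ℝ) 1)
    (B : Matrix (Fin n) (Fin m) ℝ)
    (A A' S S' S'' Lam Lam' G' : ℝ → Matrix (Fin n) (Fin n) ℝ)
    -- A is continuously differentiable with derivative A'
    (hAderiv : ∀ t ∈ Icc (0:ℝ) T, ∀ i j,
      HasDerivWithinAt (fun s => A s i j) (A' t i j) (Icc (0:ℝ) T) t)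
    (hA'cont : ∀ i j, ContinuousOn (fun t => A' t i j) (Icc (0:ℝ) T))
    -- Σ is twice continuously differentiable with derivatives S', S''
    (hSderiv : ∀ t ∈ Icc (0:ℝ) T, ∀ i j,
      HasDerivWithinAt (fun s => S s i j) (S' t i j) (Icc (0:ℝ) T) t)
    (hS'deriv : ∀ t ∈ Icc (0:ℝ) T, ∀ i j,
      HasDerivWithinAt (fun s => S' s i j) (S'' t i j) (Icc (0:ℝ) T) t)
    (hS''cont : ∀ i j, ContinuousOn (fun t => S'' t i j) (Icc (0:ℝ) T))
    -- Σ is symmetric positive definite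
    (hSpos : ∀ t ∈ Icc (0:ℝ) T, (S t).PosDef)
    -- Λ is symmetric and continuously differentiable with derivative Lam'
    (hLamSymm : ∀ t ∈ Icc (0:ℝ) T, (Lam t).IsSymm)
    (hLamDeriv : ∀ t ∈ Icc (0:ℝ) T, ∀ i j,
      HasDerivWithinAt (fun s => Lam s i j) (Lam' t i j) (Icc (0:ℝ) T) t)
    (hLam'cont : ∀ i j, ContinuousOn (fun t => Lam' t i j) (Icc (0:ℝ) T))
    -- primal (Lyapunov) equation
    (hdyn : ∀ t ∈ Icc (0:ℝ) T, S' t = A t * S t + S t * (A t)ᵀ + B * Bᵀ)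
    -- adjoint equation
    (hadj : ∀ t ∈ Icc (0:ℝ) T,
      -(Lam' t) = Lam t * A t + (A t)ᵀ * Lam t - (1 - α) • ((A' t)ᵀ * A' t))
    -- `t ↦ ȦΣ` is continuously differentiable with derivative G', and stationarity holds
    (hGderiv : ∀ t ∈ Icc (0:ℝ) T, ∀ i j,
      HasDerivWithinAt (fun s => (A' s * S s) i j) (G' t i j) (Icc (0:ℝ) T) t)
    (hG'cont : ∀ i j, ContinuousOn (fun t => G' t i j) (Icc (0:ℝ) T))
    (hstat : ∀ t ∈ Icc (0:ℝ) T,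
      Lam t * S t = α • A t - (1 - α) • G' t) :
    (∀ i j, ContDiffOn ℝ (⊤ : ℕ∞) (fun t => A t i j) (Icc (0:ℝ) T)) ∧
    (∀ i j, ContDiffOn ℝ (⊤ : ℕ∞) (fun t => S t i j) (Icc (0:ℝ) T)) ∧
    (∀ i j, ContDiffOn ℝ (⊤ : ℕ∞) (fun t => Lam t i j) (Icc (0:ℝ) T)) := by
  have key : ∀ k : ℕ, EntryC k (Icc (0:ℝ) T) A ∧ EntryC k (Icc (0:ℝ) T) S ∧
      EntryC k (Icc (0:ℝ) T) Lam ∧ EntryC k (Icc (0:ℝ) T) (fun t => A' t * S t) := by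
    intro k
    induction k with
    | zero =>
      have h0 : ∀ M M' : ℝ → Matrix (Fin n) (Fin n) ℝ, (∀ t ∈ Icc (0:ℝ) T, ∀ i j,
          HasDerivWithinAt (fun s => M s i j) (M' t i j) (Icc (0:ℝ) T) t) →
          EntryC 0 (Icc (0:ℝ) T) M := by
        intro M M' h i j
        simp only [Nat.cast_zero, contDiffOn_zero]
        exact fun t ht => (h t ht i j).continuousWithinAt
      exact ⟨h0 _ _ hAderiv, h0 _ _ hSderiv, h0 _ _ hLamDeriv, h0 _ _ hGderiv⟩
    | succ k ih =>
      obtain ⟨hA, hS, hL, hG⟩ := ih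
      have hdet : ∀ t ∈ Icc (0:ℝ) T, (S t).det ≠ 0 := fun t ht => (hSpos t ht).det_pos.ne'
      have hA' : EntryC k (Icc (0:ℝ) T) A' := (hG.mul (hS.inv hdet)).congr (fun t ht =>
        (Matrix.mul_nonsing_inv_cancel_right (S t) (A' t) (hdet t ht).isUnit).symm)
      have hS' : EntryC k (Icc (0:ℝ) T) S' :=
        (((hA.mul hS).add (hS.mul hA.transpose)).add (EntryC.const (B * Bᵀ))).congr hdyn
      have hL' : EntryC k (Icc (0:ℝ) T) Lam' :=
        (EntryC.smul (-1) (((hL.mul hA).add (hA.transpose.mul hL)).sub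
          (EntryC.smul (1 - α) (hA'.transpose.mul hA')))).congr (fun t ht => by
            rw [← hadj t ht]; simp)
      have h1 : (1 - α) ≠ 0 := (sub_pos.2 hα.2).ne'
      have hG' : EntryC k (Icc (0:ℝ) T) G' :=
        (EntryC.smul (1 - α)⁻¹ ((EntryC.smul α hA).sub (hL.mul hS))).congr (fun t ht => by
          rw [hstat t ht, sub_sub_cancel, smul_smul, inv_mul_cancel₀ h1, one_smul])
      exact ⟨hA'.succ hT hAderiv, hS'.succ hT hSderiv, hL'.succ hT hLamDeriv,
        hG'.succ hT hGderiv⟩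
  refine ⟨fun i j => ?_, fun i j => ?_, fun i j => ?_⟩
  · exact contDiffOn_infty.2 (fun k => (key k).1 i j)
  · exact contDiffOn_infty.2 (fun k => (key k).2.1 i j)
  · exact contDiffOn_infty.2 (fun k => (key k).2.2.1 i j)
end
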